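/- Let b : V(T) → ℕ≥1 be a bucket-size function on a rooted tree T with total size m = Σ_{v∈T} b(v), and define the bucket hook-length h^[b](v) = Σ_{u descendant of v} b(u). Then the number of increasing multilabellings of T in which each node v receives exactly b(v) labels from {1,...,m} equals m! divided by the product over v of the falling factorial (h^[b](v))(h^[b](v)-1)···(h^[b](v)-b(v)+1). -/

import Mathlib

open scoped BigOperators

namespace BucketTree

open Finset

open scoped Classical in
/-- The increasing multilabellings, with label set `L`, of the forest induced on the node set `S`;
nodes outside `S` receive no label. -/
noncomputable def multilabellings {V α : Type*} [Fintype V] [Fintype α] [LinearOrder α]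
    (r : V) (parent : V → V) (b : V → ℕ) (S : Finset V) (L : Finset α) :
    Finset (V → Finset α) :=
  univ.filter fun ℓ =>
    (∀ v ∈ S, (ℓ v).card = b v) ∧
    (∀ v ∉ S, ℓ v = ∅) ∧
    (∀ v w : V, v ≠ w → Disjoint (ℓ v) (ℓ w)) ∧
    (∀ x, x ∈ L ↔ ∃ v, x ∈ ℓ v) ∧
    (∀ w : V, w ≠ r → ∀ a ∈ ℓ (parent w), ∀ c ∈ ℓ w, a < c)

open scoped Classical in
/-- The descendants of `v`, including `v` itself. -/
noncomputable def descendants {V : Type*} [Fintype V] (parent : V → V) (v : V) : Finset V :=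
  univ.filter fun u => ∃ j : ℕ, parent^[j] u = v

section Tree

variable {V : Type*} {r : V} {parent : V → V}

lemma exists_topmost (hreach : ∀ v : V, ∃ j : ℕ, parent^[j] v = r) {S : Finset V}
    (hS : S.Nonempty) : ∃ v ∈ S, v = r ∨ parent v ∉ S := by
  by_contra! hcon
  obtain ⟨w, hw⟩ := hS
  have hmem : ∀ j, parent^[j] w ∈ S := by
    intro j
    induction j with
    | zero => exact hw
    | succ j ih =>
      rw [Function.iterate_succ_apply']
      exact (hcon _ ih).2
  obtain ⟨j, hj⟩ := hreach w
  exact (hcon _ (hmem j)).1 hj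

variable [Fintype V]

lemma mem_descendants {u v : V} : u ∈ descendants parent v ↔ ∃ j : ℕ, parent^[j] u = v := by
  simp [descendants]

lemma self_mem_descendants (v : V) : v ∈ descendants parent v :=
  mem_descendants.2 ⟨0, rfl⟩

lemma mem_descendants_of_parent_mem {v w : V} (h : parent w ∈ descendants parent v) :
    w ∈ descendants parent v := by
  obtain ⟨j, hj⟩ := mem_descendants.1 h
  exact mem_descendants.2 ⟨j + 1, by rwa [Function.iterate_succ_apply]⟩

lemma descendants_subset {S : Finset V} (hS : ∀ w, parent w ∈ S → w ∈ S) {v : V} (hv : v ∈ S) :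
    descendants parent v ⊆ S := by
  intro u hu
  obtain ⟨j, hj⟩ := mem_descendants.1 hu
  induction j generalizing u with
  | zero =>
    obtain rfl : u = v := hj
    exact hv
  | succ j ih => exact hS u (ih (mem_descendants.2 ⟨j, hj⟩) hj)

lemma eq_root_of_parent_mem_descendants (hroot : parent r = r)
    (hreach : ∀ v : V, ∃ j : ℕ, parent^[j] v = r) {v : V}
    (h : parent v ∈ descendants parent v) : v = r := by
  obtain ⟨j, hj⟩ := mem_descendants.1 h
  obtain ⟨k, hk⟩ := hreach v
  have hper : Function.IsPeriodicPt parent (j + 1) v := hj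
  have h1 : parent^[(j + 1) * k] v = v := hper.mul_const k
  rw [show (j + 1) * k = j * k + k by ring, Function.iterate_add_apply, hk,
    Function.iterate_fixed hroot] at h1
  exact h1.symm

lemma parent_mem_sdiff_descendants [DecidableEq V] (hroot : parent r = r) {S : Finset V}
    (hS : ∀ w, parent w ∈ S → w ∈ S) {v : V} (htop : v = r ∨ parent v ∉ S) {w : V}
    (hw : parent w ∈ S \ descendants parent v) : w ∈ S \ descendants parent v := by
  rw [mem_sdiff] at hw ⊢
  refine ⟨hS w hw.1, fun hwD => ?_⟩
  obtain ⟨j, hj⟩ := mem_descendants.1 hwD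
  cases j with
  | zero =>
    obtain rfl : w = v := hj
    rcases htop with rfl | h
    · exact hw.2 (by rw [hroot]; exact self_mem_descendants _)
    · exact h hw.1
  | succ j => exact hw.2 (mem_descendants.2 ⟨j, hj⟩)

lemma parent_mem_erase_descendants [DecidableEq V] (hroot : parent r = r)
    (hreach : ∀ v : V, ∃ j : ℕ, parent^[j] v = r) {v w : V}
    (hw : parent w ∈ (descendants parent v).erase v) : w ∈ (descendants parent v).erase v := by
  rw [mem_erase] at hw ⊢
  refine ⟨?_, mem_descendants_of_parent_mem hw.2⟩
  rintro rfl
  have := eq_root_of_parent_mem_descendants hroot hreach hw.2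
  subst this
  exact hw.1 hroot

end Tree

section InitialSegment

variable {α : Type*} [LinearOrder α]

lemma exists_initial_subset (L : Finset α) {k : ℕ} (hk : k ≤ L.card) :
    ∃ B ⊆ L, B.card = k ∧ ∀ a ∈ B, ∀ c ∈ L \ B, a < c := by
  induction k with
  | zero => exact ⟨∅, by simp⟩
  | succ k ih =>
    obtain ⟨B, hBL, hBk, hB⟩ := ih (by omega)
    have hne : (L \ B).Nonempty := by
      rw [← card_pos, card_sdiff_of_subset hBL]
      omega
    have hmem := min'_mem _ hne
    have hmin := fun c hc => min'_le (L \ B) c hc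
    set x := (L \ B).min' hne
    refine ⟨insert x B, ?_, ?_, ?_⟩
    · grind
    · grind
    · intro a ha c hc
      have := hmin c
      have := hB a
      grind

lemma initial_subset_unique {L B C : Finset α} (hBL : B ⊆ L) (hCL : C ⊆ L)
    (hcard : B.card = C.card) (hB : ∀ a ∈ B, ∀ c ∈ L \ B, a < c)
    (hC : ∀ a ∈ C, ∀ c ∈ L \ C, a < c) : B = C := by
  refine eq_of_subset_of_card_le (fun x hx => ?_) hcard.ge
  by_contra hxC
  have hCB : ¬ C ⊆ B := fun h => hxC (eq_of_subset_of_card_le h hcard.le ▸ hx)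
  obtain ⟨y, hyC, hyB⟩ := not_subset.1 hCB
  exact lt_asymm (hB x hx y (mem_sdiff.2 ⟨hCL hyC, hyB⟩)) (hC y hyC x (mem_sdiff.2 ⟨hBL hx, hxC⟩))

end InitialSegment

section Counting

variable {V α : Type*} [Fintype V] [Fintype α] [LinearOrder α] {r : V} {parent : V → V} {b : V → ℕ}

lemma mem_multilabellings {S : Finset V} {L : Finset α} {ℓ : V → Finset α} :
    ℓ ∈ multilabellings r parent b S L ↔
      (∀ v ∈ S, (ℓ v).card = b v) ∧
      (∀ v ∉ S, ℓ v = ∅) ∧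
      (∀ v w : V, v ≠ w → Disjoint (ℓ v) (ℓ w)) ∧
      (∀ x, x ∈ L ↔ ∃ v, x ∈ ℓ v) ∧
      (∀ w : V, w ≠ r → ∀ a ∈ ℓ (parent w), ∀ c ∈ ℓ w, a < c) := by
  simp [multilabellings]

lemma card_multilabellings_empty :
    (multilabellings r parent b ∅ (∅ : Finset α)).card = 1 := by
  rw [card_eq_one]
  refine ⟨fun _ => ∅, ?_⟩
  ext ℓ
  rw [mem_multilabellings, mem_singleton]
  constructor
  · intro h
    funext v
    exact h.2.1 v (notMem_empty v)
  · rintro rfl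
    simp

lemma restrict_mem_multilabellings [DecidableEq V] {S D : Finset V} (hDS : D ⊆ S)
    {L : Finset α} {ℓ : V → Finset α} (h : ℓ ∈ multilabellings r parent b S L) :
    (fun v => if v ∈ D then ℓ v else ∅) ∈ multilabellings r parent b D (D.biUnion ℓ) := by
  rw [mem_multilabellings] at h ⊢
  obtain ⟨h1, h2, h3, h4, h5⟩ := h
  refine ⟨?_, ?_, ?_, ?_, ?_⟩
  · intro v hv
    simpa [hv] using h1 v (hDS hv)
  · intro v hv
    simp [hv]
  · intro v w hvw
    have := h3 v w hvw
    split_ifs <;> simp [this]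
  · intro x
    simp only [mem_biUnion]
    grind
  · intro w hw a ha c hc
    have := h5 w hw a
    grind

lemma union_mem_multilabellings [DecidableEq V] {D E : Finset V}
    (hD : ∀ w, parent w ∈ D → w ∈ D) (hE : ∀ w, parent w ∈ E → w ∈ E) (hDE : Disjoint D E)
    {A B : Finset α} (hAB : Disjoint A B) {f g : V → Finset α}
    (hf : f ∈ multilabellings r parent b D A) (hg : g ∈ multilabellings r parent b E B) :
    (fun v => f v ∪ g v) ∈ multilabellings r parent b (D ∪ E) (A ∪ B) := by
  rw [mem_multilabellings] at hf hg ⊢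
  obtain ⟨f1, f2, f3, f4, f5⟩ := hf
  obtain ⟨g1, g2, g3, g4, g5⟩ := hg
  rw [disjoint_left] at hDE hAB
  simp only [disjoint_left] at f3 g3 ⊢
  have hfA : ∀ v x, x ∈ f v → x ∈ A := fun v x hx => (f4 x).2 ⟨v, hx⟩
  have hgB : ∀ v x, x ∈ g v → x ∈ B := fun v x hx => (g4 x).2 ⟨v, hx⟩
  refine ⟨?_, ?_, ?_, ?_, ?_⟩
  · intro v hv
    rcases mem_union.1 hv with h | h
    · simp [g2 v (hDE h), f1 v h]
    · simp [f2 v (fun h' => hDE h' h), g1 v h]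
  · intro v hv
    rw [mem_union, not_or] at hv
    simp [f2 v hv.1, g2 v hv.2]
  · intro v w hvw x
    have := f3 v w hvw (a := x)
    have := g3 v w hvw (a := x)
    clear f3 g3 f5 g5 hD hE f4 g4
    grind
  · intro x
    simp only [mem_union, f4, g4, exists_or]
  · intro w hw a ha c hc
    have hfD : ∀ v x, x ∈ f v → v ∈ D := fun v x hx => by
      by_contra hv
      simp [f2 v hv] at hx
    have hgE : ∀ v x, x ∈ g v → v ∈ E := fun v x hx => by
      by_contra hv
      simp [g2 v hv] at hx
    rcases mem_union.1 ha with ha | ha <;> rcases mem_union.1 hc with hc | hc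
    · exact f5 w hw a ha c hc
    · exact absurd (hgE _ _ hc) (hDE (hD w (hfD _ _ ha)))
    · exact absurd (hE w (hgE _ _ ha)) (hDE (hfD _ _ hc))
    · exact g5 w hw a ha c hc

lemma card_multilabellings_union [DecidableEq V] {D E : Finset V}
    (hD : ∀ w, parent w ∈ D → w ∈ D) (hE : ∀ w, parent w ∈ E → w ∈ E) (hDE : Disjoint D E)
    (L : Finset α) :
    (multilabellings r parent b (D ∪ E) L).card =
      ∑ A ∈ L.powersetCard (∑ v ∈ D, b v),
        (multilabellings r parent b D A).card * (multilabellings r parent b E (L \ A)).card := by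
  rw [card_eq_sum_card_fiberwise (f := fun ℓ => D.biUnion ℓ)
    (t := L.powersetCard (∑ v ∈ D, b v))]
  · refine sum_congr rfl fun A hA => ?_
    have hAL := (mem_powersetCard.1 hA).1
    rw [← card_product]
    refine card_nbij'
      (fun ℓ => (fun v => if v ∈ D then ℓ v else ∅, fun v => if v ∈ E then ℓ v else ∅))
      (fun p v => p.1 v ∪ p.2 v) ?_ ?_ ?_ ?_
    · intro ℓ hℓ
      obtain ⟨hℓ, hDA⟩ := mem_filter.1 hℓ
      have hEA : E.biUnion ℓ = L \ A := by
        obtain ⟨-, h2, h3, h4, -⟩ := mem_multilabellings.1 hℓ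
        rw [disjoint_left] at hDE
        simp only [disjoint_left] at h3
        subst hDA
        ext x
        simp only [mem_biUnion, mem_sdiff, h4]
        grind
      refine mem_product.2 ⟨?_, ?_⟩
      · simpa only [← hDA] using restrict_mem_multilabellings subset_union_left hℓ
      · simpa only [← hEA] using restrict_mem_multilabellings subset_union_right hℓ
    · rintro ⟨f, g⟩ hfg
      obtain ⟨hf, hg⟩ := mem_product.1 hfg
      have hu := union_mem_multilabellings hD hE hDE disjoint_sdiff hf hg
      rw [union_sdiff_of_subset hAL] at hu
      refine mem_filter.2 ⟨hu, ?_⟩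
      obtain ⟨-, f2, -, f4, -⟩ := mem_multilabellings.1 hf
      obtain ⟨-, g2, -, -, -⟩ := mem_multilabellings.1 hg
      rw [disjoint_left] at hDE
      ext x
      simp only [mem_biUnion, f4]
      grind
    · intro ℓ hℓ
      obtain ⟨-, h2, -, -, -⟩ := mem_multilabellings.1 (mem_filter.1 hℓ).1
      rw [disjoint_left] at hDE
      funext v
      grind
    · rintro ⟨f, g⟩ hfg
      obtain ⟨hf, hg⟩ := mem_product.1 hfg
      obtain ⟨-, f2, -, -, -⟩ := mem_multilabellings.1 hf
      obtain ⟨-, g2, -, -, -⟩ := mem_multilabellings.1 hg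
      rw [disjoint_left] at hDE
      refine Prod.ext ?_ ?_ <;> funext v <;> grind
  · intro ℓ hℓ
    obtain ⟨h1, -, h3, h4, -⟩ := mem_multilabellings.1 hℓ
    refine mem_coe.2 (mem_powersetCard.2 ⟨?_, ?_⟩)
    · intro x hx
      obtain ⟨v, -, hv⟩ := mem_biUnion.1 hx
      exact (h4 x).2 ⟨v, hv⟩
    · rw [card_biUnion fun v _ w _ hvw => h3 v w hvw]
      exact sum_congr rfl fun v hv => h1 v (mem_union_left _ hv)

lemma label_lt_of_mem_descendants (hroot : parent r = r) (hb : ∀ v, 1 ≤ b v) {v : V}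
    {S : Finset V} (hS : descendants parent v ⊆ S)
    {L : Finset α} {ℓ : V → Finset α} (h : ℓ ∈ multilabellings r parent b S L) {u : V}
    (hu : u ∈ descendants parent v) (huv : u ≠ v) {a c : α} (ha : a ∈ ℓ v) (hc : c ∈ ℓ u) :
    a < c := by
  obtain ⟨h1, -, -, -, h5⟩ := mem_multilabellings.1 h
  obtain ⟨j, hj⟩ := mem_descendants.1 hu
  induction j generalizing u c with
  | zero => exact absurd hj huv
  | succ j ih =>
    have hur : u ≠ r := by
      rintro rfl
      exact huv ((Function.iterate_fixed hroot _).symm.trans hj)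
    by_cases hp : parent u = v
    · exact h5 u hur a (hp ▸ ha) c hc
    · have hpD : parent u ∈ descendants parent v := mem_descendants.2 ⟨j, hj⟩
      obtain ⟨d, hd⟩ : (ℓ (parent u)).Nonempty := by
        rw [← card_pos, h1 _ (hS hpD)]
        exact hb _
      exact (ih hpD hp hd hj).trans (h5 u hur d hd c hc)

lemma card_multilabellings_descendants [DecidableEq V] (hroot : parent r = r)
    (hreach : ∀ v : V, ∃ j : ℕ, parent^[j] v = r) (hb : ∀ v, 1 ≤ b v) {v : V} {L B : Finset α}
    (hBL : B ⊆ L) (hBcard : B.card = b v) (hB : ∀ a ∈ B, ∀ c ∈ L \ B, a < c) :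
    (multilabellings r parent b (descendants parent v) L).card =
      (multilabellings r parent b ((descendants parent v).erase v) (L \ B)).card := by
  have hroot_label : ∀ ℓ ∈ multilabellings r parent b (descendants parent v) L, ℓ v = B := by
    intro ℓ hℓ
    obtain ⟨h1, h2, -, h4, -⟩ := mem_multilabellings.1 hℓ
    refine initial_subset_unique (fun x hx => (h4 x).2 ⟨v, hx⟩) hBL
      ((h1 v (self_mem_descendants v)).trans hBcard.symm) ?_ hB
    intro a ha c hc
    obtain ⟨hcL, hcv⟩ := mem_sdiff.1 hc
    obtain ⟨u, hu⟩ := (h4 c).1 hcL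
    have huD : u ∈ descendants parent v := by
      by_contra hn
      simp [h2 u hn] at hu
    exact label_lt_of_mem_descendants hroot hb subset_rfl hℓ huD
      (by rintro rfl; exact hcv hu) ha hu
  refine card_nbij' (fun ℓ => Function.update ℓ v ∅) (fun ℓ => Function.update ℓ v B) ?_ ?_ ?_ ?_
  · intro ℓ hℓ
    have hv := hroot_label ℓ hℓ
    obtain ⟨h1, h2, h3, h4, h5⟩ := mem_multilabellings.1 hℓ
    simp only [disjoint_left] at h3
    rw [mem_coe, mem_multilabellings]
    beta_reduce
    refine ⟨?_, ?_, ?_, ?_, ?_⟩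
    · grind
    · grind
    · simp only [disjoint_left]
      grind
    · intro x
      rw [mem_sdiff, h4, ← hv]
      constructor
      · rintro ⟨⟨u, hu⟩, hxv⟩
        refine ⟨u, ?_⟩
        rwa [Function.update_of_ne]
        rintro rfl
        exact hxv hu
      · rintro ⟨u, hu⟩
        by_cases huv : u = v
        · simp [huv] at hu
        · rw [Function.update_of_ne huv] at hu
          exact ⟨⟨u, hu⟩, h3 u v huv hu⟩
    · intro w hw a ha c hc
      have := h5 w hw a
      grind
  · intro ℓ hℓ
    obtain ⟨h1, h2, h3, h4, h5⟩ := mem_multilabellings.1 hℓ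
    simp only [disjoint_left] at h3
    have hvD := self_mem_descendants (parent := parent) v
    have hv : ℓ v = ∅ := h2 v (by simp)
    have hmem : ∀ u x, x ∈ ℓ u → x ∈ L ∧ x ∉ B := fun u x hx =>
      mem_sdiff.1 ((h4 x).2 ⟨u, hx⟩)
    rw [mem_coe, mem_multilabellings]
    beta_reduce
    refine ⟨?_, ?_, ?_, ?_, ?_⟩
    · grind
    · grind
    · simp only [disjoint_left]
      intro u w huw x
      have := h3 u w huw (a := x)
      have := hmem u x
      have := hmem w x
      clear h1 h2 h3 h4 h5
      grind
    · intro x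
      constructor
      · intro hx
        by_cases hxB : x ∈ B
        · exact ⟨v, by rwa [Function.update_self]⟩
        · obtain ⟨u, hu⟩ := (h4 x).1 (mem_sdiff.2 ⟨hx, hxB⟩)
          refine ⟨u, ?_⟩
          rwa [Function.update_of_ne]
          rintro rfl
          simp [hv] at hu
      · rintro ⟨u, hu⟩
        by_cases huv : u = v
        · rw [huv, Function.update_self] at hu
          exact hBL hu
        · rw [Function.update_of_ne huv] at hu
          exact (hmem u x hu).1
    · intro w hw a ha c hc
      by_cases hwv : w = v
      · subst hwv
        have hpw : parent w ≠ w :=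
          fun h => hw (eq_root_of_parent_mem_descendants hroot hreach (by rw [h]; exact hvD))
        rw [Function.update_of_ne hpw] at ha
        have hpD : parent w ∈ descendants parent w := by
          by_contra hn
          simp [h2 (parent w) (fun h => hn (mem_of_mem_erase h))] at ha
        exact absurd (eq_root_of_parent_mem_descendants hroot hreach hpD) hw
      · rw [Function.update_of_ne hwv] at hc
        by_cases hpv : parent w = v
        · rw [hpv, Function.update_self] at ha
          exact hB a ha c ((h4 c).2 ⟨w, hc⟩)
        · rw [Function.update_of_ne hpv] at ha
          exact h5 w hw a ha c hc
  · intro ℓ hℓ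
    have hv := hroot_label ℓ hℓ
    simp [← hv]
  · intro ℓ hℓ
    obtain ⟨-, h2, -, -, -⟩ := mem_multilabellings.1 hℓ
    have hv : ℓ v = ∅ := h2 v (by simp)
    simp [← hv]

theorem card_multilabellings_mul_prod (hroot : parent r = r)
    (hreach : ∀ v : V, ∃ j : ℕ, parent^[j] v = r) (hb : ∀ v, 1 ≤ b v) (S : Finset V)
    (hS : ∀ w, parent w ∈ S → w ∈ S) (L : Finset α) (hL : L.card = ∑ v ∈ S, b v) :
    (multilabellings r parent b S L).card *
      ∏ v ∈ S, (∑ u ∈ descendants parent v, b u).descFactorial (b v) = L.card.factorial := by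
  classical
  induction S using Finset.strongInduction generalizing L with
  | H S ih =>
  rcases S.eq_empty_or_nonempty with rfl | hne
  · obtain rfl : L = ∅ := by simpa using hL
    simp [card_multilabellings_empty]
  obtain ⟨v, hvS, htop⟩ := exists_topmost hreach hne
  have hDS := descendants_subset hS hvS
  have hvD := self_mem_descendants (parent := parent) v
  have hD : ∀ w, parent w ∈ descendants parent v → w ∈ descendants parent v :=
    fun _ => mem_descendants_of_parent_mem
  have hE := fun w => parent_mem_sdiff_descendants (w := w) hroot hS htop
  have hD' := fun w => parent_mem_erase_descendants (v := v) (w := w) hroot hreach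
  set F : V → ℕ := fun v => (∑ u ∈ descendants parent v, b u).descFactorial (b v)
  set D := descendants parent v
  set h := ∑ u ∈ D, b u with hh
  have hbh : b v ≤ h := single_le_sum (f := b) (fun _ _ => Nat.zero_le _) hvD
  have hprod : ∏ v ∈ S, F v = h.descFactorial (b v) * (∏ u ∈ D.erase v, F u) * ∏ u ∈ S \ D, F u := by
    rw [← prod_sdiff hDS, ← mul_prod_erase D F hvD, mul_comm]
  have hsum : ∑ u ∈ S \ D, b u + h = L.card := by rw [hL, sum_sdiff hDS]
  have hsumD : b v + ∑ u ∈ D.erase v, b u = h := add_sum_erase D b hvD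
  have hterm : ∀ A ∈ L.powersetCard h,
      (multilabellings r parent b D A).card * (multilabellings r parent b (S \ D) (L \ A)).card *
        ∏ v ∈ S, F v = h.factorial * (L.card - h).factorial := by
    intro A hA
    obtain ⟨hAL, hAcard⟩ := mem_powersetCard.1 hA
    obtain ⟨B, hBA, hBcard, hB⟩ := exists_initial_subset A (hAcard ▸ hbh)
    have hcard1 : (A \ B).card = h - b v := by rw [card_sdiff_of_subset hBA, hAcard, hBcard]
    have hcard2 : (L \ A).card = L.card - h := by rw [card_sdiff_of_subset hAL, hAcard]
    have i1 := ih (D.erase v) ((erase_ssubset hvD).trans_subset hDS) hD' (A \ B) (by omega)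
    have i2 := ih (S \ D) (sdiff_ssubset hDS ⟨v, hvD⟩) hE (L \ A) (by omega)
    rw [card_multilabellings_descendants hroot hreach hb hBA hBcard hB, hprod, ← hcard2, ← i2,
      ← Nat.factorial_mul_descFactorial hbh, ← hcard1, ← i1]
    ring
  have hunion : S = D ∪ (S \ D) := (union_sdiff_of_subset hDS).symm
  have hcount := card_multilabellings_union (r := r) (b := b) hD hE disjoint_sdiff L
  rw [← hunion] at hcount
  rw [hcount, sum_mul, sum_congr rfl hterm, sum_const, card_powersetCard, smul_eq_mul, ← mul_assoc]
  exact Nat.choose_mul_factorial_mul_factorial (by omega)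

end Counting

end BucketTree

/-- Given a bucket-size function `b` on a rooted tree `T` with total bucket size
`m = ∑_v b v`, and bucket hook-lengths `hB v = ∑_{u descendant of v} b u`,
the number of increasing multilabellings of `T` in which node `v` receives
exactly `b v` labels from `{1,…,m}` equals
`m! / ∏_v (hB v)(hB v - 1) ⋯ (hB v - b v + 1)`. -/
theorem increasing_bucket_multilabellings_count
    (V : Type) [Fintype V] (r : V) (parent : V → V)
    (hroot : parent r = r)
    (hreach : ∀ v : V, ∃ j : ℕ, parent^[j] v = r)
    (b : V → ℕ) (hb : ∀ v : V, 1 ≤ b v)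
    (m : ℕ) (hm : m = ∑ v : V, b v)
    (hB : V → ℕ)
    (hhB : ∀ v : V, hB v = ∑ᶠ u ∈ {u : V | ∃ j : ℕ, parent^[j] u = v}, b u) :
    (Nat.card {ℓ : V → Finset (Fin m) //
        (∀ v : V, (ℓ v).card = b v) ∧
        (∀ v w : V, v ≠ w → Disjoint (ℓ v) (ℓ w)) ∧
        (∀ x : Fin m, ∃ v : V, x ∈ ℓ v) ∧
        (∀ w : V, w ≠ r → ∀ a ∈ ℓ (parent w), ∀ c ∈ ℓ w, a < c)} : ℚ)
      = (Nat.factorial m : ℚ)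
          / ∏ v : V, (Nat.descFactorial (hB v) (b v) : ℚ) := by
  classical
  have hhook : ∀ v, hB v = ∑ u ∈ BucketTree.descendants parent v, b u := by
    intro v
    rw [hhB v, ← finsum_mem_coe_finset]
    simp [BucketTree.descendants]
  have hcount := BucketTree.card_multilabellings_mul_prod (α := Fin m) hroot hreach hb
    Finset.univ (fun _ _ => Finset.mem_univ _) Finset.univ (by simpa using hm)
  rw [Finset.card_univ, Fintype.card_fin] at hcount
  simp only [← hhook] at hcount
  have hpos : ∀ v, b v ≤ hB v := fun v => by
    rw [hhook]
    exact Finset.single_le_sum (f := b) (fun _ _ => Nat.zero_le _)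
      (BucketTree.self_mem_descendants v)
  have hne : ∏ v : V, (Nat.descFactorial (hB v) (b v) : ℚ) ≠ 0 :=
    Finset.prod_ne_zero_iff.2 fun v _ => Nat.cast_ne_zero.2
      fun h => (Nat.descFactorial_eq_zero_iff_lt.1 h).not_ge (hpos v)
  rw [eq_div_iff hne, ← hcount, Nat.cast_mul, Nat.cast_prod]
  congr 2
  rw [← Nat.card_eq_finsetCard]
  refine Nat.card_congr (Equiv.subtypeEquivRight fun ℓ => ?_)
  simp [BucketTree.mem_multilabellings]
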